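/- arXiv:1311.4924 — 2 statements merged into one kernel-verified Lean document; each statement's English description precedes it below -/
import Mathlib

section
/- Let α ∈ ℝ^N be a vector whose support S = {n : αₙ ≠ 0} has cardinality at most K. Then for every v ∈ ℝ^N one has ‖α + v‖₁ ≥ ‖α‖₁ + ‖v‖₁ − 2√K·‖v‖₂. -/
/-- Cauchy–Schwarz comparison of the `ℓ¹` norm on a set of at most `K` indices with the full
`ℓ²` norm. -/
theorem sum_abs_le_sqrt_mul_sqrt_sum_sq {ι : Type*} [Fintype ι] (s : Finset ι) {K : ℕ}
    (hs : s.card ≤ K) (v : ι → ℝ) :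
    ∑ i ∈ s, |v i| ≤ Real.sqrt K * Real.sqrt (∑ i, v i ^ 2) := by
  rw [← Real.sqrt_mul (Nat.cast_nonneg K)]
  apply Real.le_sqrt_of_sq_le
  calc (∑ i ∈ s, |v i|) ^ 2 ≤ s.card * ∑ i ∈ s, |v i| ^ 2 := sq_sum_le_card_mul_sum_sq
    _ = s.card * ∑ i ∈ s, v i ^ 2 := by simp only [sq_abs]
    _ ≤ K * ∑ i, v i ^ 2 := by
      gcongr
      exact Finset.subset_univ s

/-- **Inequality (27) in the proof of Theorem 1.**
If `α` is supported on a set of at most `K` indices, then for every `v`,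
`‖α + v‖₁ ≥ ‖α‖₁ + ‖v‖₁ − 2√K‖v‖₂`. -/
theorem l1_sparse_perturbation_bound
    {N : ℕ} (K : ℕ) (α : Fin N → ℝ)
    (hsparse : (Finset.univ.filter fun n => α n ≠ 0).card ≤ K) :
    ∀ v : Fin N → ℝ,
      (∑ n, |α n|) + (∑ n, |v n|) - 2 * Real.sqrt K * Real.sqrt (∑ n, (v n) ^ 2) ≤
        ∑ n, |α n + v n| := by
  intro v
  have hcs := sum_abs_le_sqrt_mul_sqrt_sum_sq _ hsparse v
  have htri : ∑ n, (|α n| + |v n|) ≤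
      ∑ n, (|α n + v n| + 2 * if α n ≠ 0 then |v n| else 0) := by
    refine Finset.sum_le_sum fun n _ => ?_
    by_cases hn : α n = 0
    · simp [hn]
    · have h := abs_sub (α n + v n) (v n)
      rw [add_sub_cancel_right] at h
      rw [if_pos hn]
      linarith
  rw [Finset.sum_add_distrib, Finset.sum_add_distrib, ← Finset.mul_sum,
    ← Finset.sum_filter] at htri
  linarith
end

section
/- Let P ∈ ℝ^{N×N} be a symmetric positive semidefinite matrix, let λ₂ ≥ 0 and C₂ ≥ 0 satisfy √(vᵀPv) ≤ C₂‖v‖₂ for all v ∈ ℝ^N, and let α ∈ ℝ^N have at most K nonzero entries. Then for every v ∈ ℝ^N: ‖α + v‖₁ + λ₂·√((α + v)ᵀP(α + v)) ≥ ‖α‖₁ + λ₂·√(αᵀPα) + ‖v‖₁ − (2√K + λ₂C₂)·‖v‖₂. -/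
open Matrix

lemma dotProduct_mulVec_comm_of_isSymm {ι : Type*} [Fintype ι] {P : Matrix ι ι ℝ}
    (hP : P.IsSymm) (x y : ι → ℝ) : x ⬝ᵥ P.mulVec y = y ⬝ᵥ P.mulVec x := by
  rw [dotProduct_mulVec, ← mulVec_transpose, hP.eq, dotProduct_comm]

/-- Cauchy–Schwarz for the bilinear form of a symmetric positive semidefinite matrix. -/
lemma sq_dotProduct_mulVec_le {ι : Type*} [Fintype ι] {P : Matrix ι ι ℝ} (hP : P.IsSymm)
    (hpsd : ∀ v : ι → ℝ, 0 ≤ v ⬝ᵥ P.mulVec v) (x y : ι → ℝ) :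
    (x ⬝ᵥ P.mulVec y) ^ 2 ≤ (x ⬝ᵥ P.mulVec x) * (y ⬝ᵥ P.mulVec y) := by
  have hquad (t : ℝ) : 0 ≤ (y ⬝ᵥ P.mulVec y) * (t * t) + (2 * (x ⬝ᵥ P.mulVec y)) * t +
      x ⬝ᵥ P.mulVec x := by
    have h := hpsd (x + t • y)
    simp only [mulVec_add, mulVec_smul, add_dotProduct, dotProduct_add, smul_dotProduct,
      dotProduct_smul, smul_eq_mul, dotProduct_mulVec_comm_of_isSymm hP y x] at h
    linarith
  have h := discrim_le_zero hquad
  rw [discrim] at h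
  linarith

/-- The triangle inequality for the seminorm of a symmetric positive semidefinite matrix. -/
lemma sqrt_dotProduct_mulVec_add_le {ι : Type*} [Fintype ι] {P : Matrix ι ι ℝ} (hP : P.IsSymm)
    (hpsd : ∀ v : ι → ℝ, 0 ≤ v ⬝ᵥ P.mulVec v) (x y : ι → ℝ) :
    √((x + y) ⬝ᵥ P.mulVec (x + y)) ≤ √(x ⬝ᵥ P.mulVec x) + √(y ⬝ᵥ P.mulVec y) := by
  have hcs : x ⬝ᵥ P.mulVec y ≤ √(x ⬝ᵥ P.mulVec x) * √(y ⬝ᵥ P.mulVec y) := by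
    rw [← Real.sqrt_mul (hpsd x)]
    exact Real.le_sqrt_of_sq_le (sq_dotProduct_mulVec_le hP hpsd x y)
  refine Real.sqrt_le_iff.mpr ⟨by positivity, ?_⟩
  rw [add_sq, Real.sq_sqrt (hpsd x), Real.sq_sqrt (hpsd y)]
  simp only [mulVec_add, add_dotProduct, dotProduct_add, dotProduct_mulVec_comm_of_isSymm hP y x]
  linarith

/-- The sum of absolute values over `s` is at most `√(#s)` times the Euclidean norm. -/
lemma sum_abs_le_sqrt_card_mul_sqrt {ι : Type*} [Fintype ι] (s : Finset ι) (v : ι → ℝ) :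
    ∑ n ∈ s, |v n| ≤ √s.card * √(∑ n, (v n) ^ 2) := by
  rw [← Real.sqrt_mul (Nat.cast_nonneg _)]
  refine Real.le_sqrt_of_sq_le (sq_sum_le_card_mul_sum_sq.trans ?_)
  simp only [sq_abs]
  gcongr
  exact s.subset_univ

/-- The ℓ1 norm is almost additive when one of the summands is sparse. -/
lemma sum_abs_add_sum_abs_le {ι : Type*} [Fintype ι] {K : ℕ} {α : ι → ℝ}
    (hα : (Finset.univ.filter fun n => α n ≠ 0).card ≤ K) (v : ι → ℝ) :
    (∑ n, |α n|) + ∑ n, |v n| ≤ (∑ n, |α n + v n|) + 2 * √K * √(∑ n, (v n) ^ 2) := by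
  have hpoint (n : ι) : |α n| + |v n| ≤ |α n + v n| + 2 * (if α n ≠ 0 then |v n| else 0) := by
    split_ifs with h
    · have := abs_sub_abs_le_abs_sub (α n) (-v n)
      rw [abs_neg, sub_neg_eq_add] at this
      linarith
    · simp [not_not.mp h]
  have hsum := Finset.sum_le_sum fun n (_ : n ∈ Finset.univ) => hpoint n
  rw [Finset.sum_add_distrib, Finset.sum_add_distrib, ← Finset.mul_sum,
    ← Finset.sum_filter] at hsum
  have hS := sum_abs_le_sqrt_card_mul_sqrt (Finset.univ.filter fun n => α n ≠ 0) v
  have hK : √((Finset.univ.filter fun n => α n ≠ 0).card : ℝ) * √(∑ n, (v n) ^ 2) ≤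
      √K * √(∑ n, (v n) ^ 2) := by
    gcongr
  linarith

/-- **Combined lower bound (30) in the proof of Theorem 1.** -/
theorem combined_lower_bound
    {N : ℕ} (K : ℕ) (P : Matrix (Fin N) (Fin N) ℝ) (hPsymm : P.IsSymm)
    (hPpsd : ∀ v : Fin N → ℝ, 0 ≤ v ⬝ᵥ P.mulVec v)
    (lam2 C2 : ℝ) (hlam2 : 0 ≤ lam2) (hC2 : 0 ≤ C2)
    (hPbound : ∀ v : Fin N → ℝ,
      Real.sqrt (v ⬝ᵥ P.mulVec v) ≤ C2 * Real.sqrt (∑ n, (v n) ^ 2))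
    (α : Fin N → ℝ)
    (hsparse : (Finset.univ.filter fun n => α n ≠ 0).card ≤ K) :
    ∀ v : Fin N → ℝ,
      (∑ n, |α n|) + lam2 * Real.sqrt (α ⬝ᵥ P.mulVec α) + (∑ n, |v n|) -
          (2 * Real.sqrt K + lam2 * C2) * Real.sqrt (∑ n, (v n) ^ 2) ≤
        (∑ n, |α n + v n|) +
          lam2 * Real.sqrt ((α + v) ⬝ᵥ P.mulVec (α + v)) := by
  intro v
  have hl1 := sum_abs_add_sum_abs_le hsparse v
  have htri := sqrt_dotProduct_mulVec_add_le hPsymm hPpsd (α + v) (-v)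
  have hbound := hPbound (-v)
  simp only [Pi.neg_apply, neg_sq] at hbound
  rw [add_neg_cancel_right] at htri
  have hsemi := mul_le_mul_of_nonneg_left (htri.trans (add_le_add_right hbound _)) hlam2
  linarith
end
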